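/- Let A ⊆ B be an extension of commutative rings with B reduced, and let M ⊆ N be an extension of positive commutative cancellative torsion-free monoids. If A is subintegrally closed in B and M is subintegrally closed in N, then the canonical group homomorphism θ : 𝓘(A,B) → 𝓘(A[M],B[N]), sending an invertible A-submodule I of B to the A[M]-submodule of B[N] generated by I, is an isomorphism. -/

import Mathlib

open scoped Classical

noncomputable section

/-- `A` is subintegrally closed in its ambient ring `B`:
every `b : B` with `b² ∈ A` and `b³ ∈ A` lies in `A`. -/
def Subring.IsSubintegrallyClosedIn {B : Type*} [CommRing B] (A : Subring B) : Prop :=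
  ∀ b : B, b ^ 2 ∈ A → b ^ 3 ∈ A → b ∈ A

/-- `M` is subintegrally closed in its ambient monoid `N`:
every `x : N` with `x² ∈ M` and `x³ ∈ M` lies in `M`. -/
def Submonoid.IsSubintegrallyClosedIn {N : Type*} [CommMonoid N] (M : Submonoid N) : Prop :=
  ∀ x : N, x ^ 2 ∈ M → x ^ 3 ∈ M → x ∈ M

/-- A commutative monoid is torsion-free. -/
def MulTorsionFree (N : Type*) [CommMonoid N] : Prop :=
  ∀ (x y : N) (n : ℕ), n ≠ 0 → x ^ n = y ^ n → x = y

/-- A commutative monoid is positive if its only unit is the identity. -/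
def IsPositiveMonoid (N : Type*) [CommMonoid N] : Prop :=
  ∀ x : N, IsUnit x → x = 1

/-- The subring `A[M]` of the monoid algebra `B[N]`, for a subring `A ⊆ B` and a submonoid
`M ⊆ N`: the subring generated by the elements `a·m` (`a ∈ A`, `m ∈ M`); equivalently, the set
of elements of `B[N]` supported on `M` with all coefficients in `A`. -/
def monoidAlgebraSubring {B : Type*} [CommRing B] {N : Type*} [CommMonoid N]
    (A : Subring B) (M : Submonoid N) : Subring (MonoidAlgebra B N) :=
  Subring.closure {x | ∃ a ∈ A, ∃ m ∈ M, x = MonoidAlgebra.single m a}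

/-- The canonical group homomorphism `θ : 𝓘(A,B) → 𝓘(A[M],B[N])`, sending an invertible
`A`-submodule `I` of `B` to the `A[M]`-submodule of `B[N]` generated by (the image of) `I`,
is an isomorphism of groups.  This is phrased as: there is a group isomorphism
`𝓘(A,B) ≃* 𝓘(A[M],B[N])` whose underlying map is the canonical one. -/
def ThetaIsIso {B : Type*} [CommRing B] {N : Type*} [CancelCommMonoid N]
    (A : Subring B) (M : Submonoid N) : Prop :=
  ∃ e : (Submodule A B)ˣ ≃* (Submodule (monoidAlgebraSubring A M) (MonoidAlgebra B N))ˣ,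
    ∀ I : (Submodule A B)ˣ,
      (e I : Submodule (monoidAlgebraSubring A M) (MonoidAlgebra B N)) =
        Submodule.span (monoidAlgebraSubring A M)
          (⇑(MonoidAlgebra.singleOneRingHom : B →+* MonoidAlgebra B N) ''
            ((I : Submodule A B) : Set B))

open Polynomial

section
attribute [local instance] Polynomial.algebra

theorem Polynomial.exists_unit_span_eq_of_mul_mem_lifts {ι K E : Type*} [Fintype ι] [Field K]
    [CommRing E] [Nontrivial E] [Algebra K E] (f g : ι → E[X])
    (hfg : ∀ i j, f i * g j ∈ lifts (algebraMap K E)) (h1 : ∑ i, f i * g i = 1) :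
    ∃ u : E[X]ˣ, ∀ i, ∃ p : K[X], f i = p.map (algebraMap K E) * u := by
  set I := Submodule.span K[X] (Set.range f)
  set J := Submodule.span K[X] (Set.range g)
  have hIJ : I * J = 1 := by
    apply le_antisymm
    · rw [Submodule.span_mul_span, Submodule.span_le]
      rintro _ ⟨_, ⟨i, rfl⟩, _, ⟨j, rfl⟩, rfl⟩
      obtain ⟨p, hp⟩ := (mem_lifts _).mp (hfg i j)
      exact Submodule.mem_one.mpr ⟨p, hp⟩
    · rw [Submodule.one_le, ← h1]
      exact Submodule.sum_mem _ fun i _ ↦ Submodule.mul_mem_mul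
        (Submodule.subset_span ⟨i, rfl⟩) (Submodule.subset_span ⟨i, rfl⟩)
  let U : (Submodule K[X] E[X])ˣ := ⟨I, J, hIJ, by rw [mul_comm, hIJ]⟩
  have hU : U ∈ (Submodule.unitsToPic K[X] E[X]).ker := Subsingleton.elim _ _
  rw [Submodule.ker_unitsToPic] at hU
  obtain ⟨u, hu⟩ := hU
  refine ⟨u, fun i ↦ ?_⟩
  have : f i ∈ Submodule.span K[X] {(u : E[X])} := by
    have h2 : Submodule.span K[X] {(u : E[X])} = I := congr_arg Units.val hu
    rw [h2]
    exact Submodule.subset_span ⟨i, rfl⟩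
  obtain ⟨p, hp⟩ := Submodule.mem_span_singleton.mp this
  exact ⟨p, by rw [← hp, Algebra.smul_def]; rfl⟩
end

theorem Polynomial.coeff_mem_range_of_mul_mem_lifts {ι K E : Type*} [Fintype ι] [Field K]
    [CommRing E] [IsReduced E] [Algebra K E] (f g : ι → E[X])
    (hfg : ∀ i j, f i * g j ∈ lifts (algebraMap K E)) (h1 : ∑ i, f i * g i = 1)
    (hf : ∀ i, (f i).coeff 0 ∈ (algebraMap K E).range) (i : ι) (n : ℕ) :
    (f i).coeff n ∈ (algebraMap K E).range := by
  nontriviality E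
  obtain ⟨u, hu⟩ := exists_unit_span_eq_of_mul_mem_lifts f g hfg h1
  obtain ⟨e, he⟩ : ∃ e : E, (u : E[X]) = C e :=
    ⟨(u : E[X]).coeff 0, eq_C_of_natDegree_eq_zero <| by
      by_contra h
      exact not_isUnit_of_natDegree_pos_of_isReduced _ (Nat.pos_of_ne_zero h) u.isUnit⟩
  choose p hp using hu
  have hcoeff (i n) : (f i).coeff n = algebraMap K E ((p i).coeff n) * e := by
    rw [hp, he, coeff_mul_C, coeff_map]
  obtain ⟨j, hj⟩ : ∃ j, (f j).coeff 0 ≠ 0 := by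
    by_contra! h
    have := congr_arg (coeff · 0) h1
    simp [mul_coeff_zero, h] at this
  obtain ⟨c, hc⟩ := hf j
  have hpj : (p j).coeff 0 ≠ 0 := fun h ↦ hj (by rw [hcoeff, h, map_zero, zero_mul])
  have he' : e = algebraMap K E (((p j).coeff 0)⁻¹ * c) := by
    rw [map_mul, hc, hcoeff, ← mul_assoc, ← map_mul, inv_mul_cancel₀ hpj, map_one, one_mul]
  exact ⟨(p i).coeff n * (((p j).coeff 0)⁻¹ * c), by rw [map_mul, ← he', hcoeff]⟩

theorem Polynomial.isIntegral_coeff_of_mul_mem_lifts {R S : Type*} [CommRing R] [CommRing S]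
    [Algebra R S] {p q : S[X]} (hpq : p * q ∈ lifts (algebraMap R S)) (hp : p.coeff 0 = 1)
    (hq : q.coeff 0 = 1) (n : ℕ) : IsIntegral R (p.coeff n) := by
  nontriviality S
  have hmonic (r : S[X]) (hr : r.coeff 0 = 1) : (reflect r.natDegree r).Monic :=
    monic_of_natDegree_le_of_coeff_eq_one r.natDegree
      (natDegree_reflect_le.trans (by simp)) (by simp [coeff_reflect, hr])
  have hmul := reflect_mul p q le_rfl le_rfl
  have hmon : (reflect (p.natDegree + q.natDegree) (p * q)).Monic :=
    hmul ▸ (hmonic p hp).mul (hmonic q hq)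
  have hl : reflect (p.natDegree + q.natDegree) (p * q) ∈ lifts (algebraMap R S) := by
    rw [lifts_iff_coeff_lifts] at hpq ⊢
    intro k
    rw [coeff_reflect]
    exact hpq _
  obtain ⟨P, hP, -, hPm⟩ := lifts_and_degree_eq_and_monic hl hmon
  have := isIntegral_coeff_of_dvd P _ hPm (hmonic p hp) (hP ▸ hmul ▸ dvd_mul_right _ _)
    (revAt p.natDegree n)
  rwa [coeff_reflect, revAt_invol] at this

theorem Polynomial.isIntegral_coeff_of_family {ι R S : Type*} [Fintype ι] [CommRing R]
    [CommRing S] [Algebra R S] (f g : ι → S[X])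
    (hfg : ∀ i j, f i * g j ∈ lifts (algebraMap R S))
    (hf : ∀ i, (f i).coeff 0 ∈ (algebraMap R S).range)
    (hg : ∀ i, (g i).coeff 0 ∈ (algebraMap R S).range)
    (hsum : ∑ i, (f i).coeff 0 * (g i).coeff 0 = 1) (i : ι) (n : ℕ) :
    IsIntegral R ((f i).coeff n) := by
  have hC {a : S} (ha : a ∈ (algebraMap R S).range) : C a ∈ lifts (algebraMap R S) := by
    obtain ⟨r, rfl⟩ := ha
    exact C_mem_lifts _ r
  set f₀ := ∑ i, C ((g i).coeff 0) * f i with hf₀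
  set g₀ := ∑ i, C ((f i).coeff 0) * g i with hg₀
  have hf₀c : f₀.coeff 0 = 1 := by
    simpa [hf₀, finsetSum_coeff, mul_comm] using hsum
  have hg₀c : g₀.coeff 0 = 1 := by
    simpa [hg₀, finsetSum_coeff] using hsum
  have hfig (i) : f i * g₀ ∈ lifts (algebraMap R S) := by
    rw [hg₀, Finset.mul_sum]
    refine sum_mem fun j _ ↦ ?_
    rw [mul_left_comm]
    exact mul_mem (hC (hf j)) (hfg i j)
  have hf₀g : f₀ * g₀ ∈ lifts (algebraMap R S) := by
    rw [hf₀, Finset.sum_mul]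
    refine sum_mem fun j _ ↦ ?_
    rw [mul_assoc]
    exact mul_mem (hC (hg j)) (hfig j)
  have h := isIntegral_coeff_of_mul_mem_lifts (p := f₀ + X * f i) (q := g₀)
    (by
      rw [add_mul, mul_assoc]
      exact add_mem hf₀g (mul_mem (X_mem_lifts _) (hfig i))) (by simp [hf₀c]) hg₀c (n + 1)
  have h' := isIntegral_coeff_of_mul_mem_lifts hf₀g hf₀c hg₀c (n + 1)
  rw [coeff_add, coeff_X_mul] at h
  simpa using h.sub h'

theorem Ideal.exists_notMem_mul_pow_mem_of_mem_minimalPrimes {R : Type*} [CommRing R]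
    {I p : Ideal R} (hp : p ∈ I.minimalPrimes) {x : R} (hx : x ∈ p) :
    ∃ s ∉ p, ∃ n : ℕ, s * x ^ n ∈ I := by
  have := hp.isPrime
  obtain ⟨n, hn⟩ : algebraMap R (Localization.AtPrime p) x ∈ (I.map (algebraMap R _)).radical := by
    rw [IsLocalization.AtPrime.radical_map_of_mem_minimalPrimes _ p I hp]
    exact Ideal.mem_map_of_mem _ hx
  rw [← map_pow, IsLocalization.algebraMap_mem_map_algebraMap_iff p.primeCompl] at hn
  obtain ⟨s, hs, h⟩ := hn
  exact ⟨s, hs, n, h⟩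

/-- The elements of `C` multiplying all of `C` into the image of `R`. -/
def Algebra.conductorIdeal (R C : Type*) [CommRing R] [CommRing C] [Algebra R C] : Ideal C where
  carrier := {x | ∀ c, x * c ∈ (algebraMap R C).range}
  add_mem' hx hy c := by rw [add_mul]; exact add_mem (hx c) (hy c)
  zero_mem' c := by rw [zero_mul]; exact zero_mem _
  smul_mem' y x hx c := by rw [smul_eq_mul, mul_comm y, mul_assoc]; exact hx _

theorem Algebra.mem_conductorIdeal {R C : Type*} [CommRing R] [CommRing C] [Algebra R C] {x : C} :
    x ∈ conductorIdeal R C ↔ ∀ c, x * c ∈ (algebraMap R C).range := Iff.rfl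

theorem Polynomial.exists_mul_coeff_mem_range_of_mem_minimalPrimes {ι R C : Type*} [Fintype ι]
    [CommRing R] [CommRing C] [Algebra R C] (f g : ι → C[X])
    (hfg : ∀ i j, f i * g j ∈ lifts (algebraMap R C)) (h1 : ∑ i, f i * g i = 1)
    (hf : ∀ i, (f i).coeff 0 ∈ (algebraMap R C).range)
    (hrad : (Algebra.conductorIdeal R C).IsRadical) {p : Ideal R}
    (hp : p ∈ ((Algebra.conductorIdeal R C).comap (algebraMap R C)).minimalPrimes)
    (i : ι) (n : ℕ) :
    ∃ s ∉ p, algebraMap R C s * (f i).coeff n ∈ (algebraMap R C).range := by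
  have := hp.isPrime
  set I := Algebra.conductorIdeal R C
  have : IsReduced (C ⧸ I) := (Ideal.isRadical_iff_quotient_reduced I).mp hrad
  let M : Submonoid (C ⧸ I) := p.primeCompl.map ((Ideal.Quotient.mk I).comp (algebraMap R C))
  let θ : C →+* Localization M := (algebraMap (C ⧸ I) (Localization M)).comp (Ideal.Quotient.mk I)
  have hθ {x : C} : θ x = 0 ↔ ∃ s ∉ p, algebraMap R C s * x ∈ I := by
    rw [RingHom.comp_apply, IsLocalization.map_eq_zero_iff M]
    constructor
    · rintro ⟨⟨_, s, hs, rfl⟩, h⟩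
      exact ⟨s, hs, Ideal.Quotient.eq_zero_iff_mem.mp h⟩
    · rintro ⟨s, hs, h⟩
      exact ⟨⟨_, s, hs, rfl⟩, Ideal.Quotient.eq_zero_iff_mem.mpr h⟩
  have hker : p ≤ RingHom.ker (θ.comp (algebraMap R C)) := fun x hx ↦ by
    obtain ⟨s, hs, k, h⟩ := Ideal.exists_notMem_mul_pow_mem_of_mem_minimalPrimes hp hx
    rw [RingHom.mem_ker, RingHom.comp_apply, hθ]
    refine ⟨s, hs, hrad ⟨k + 1, ?_⟩⟩
    rw [← map_mul, ← map_pow, ← Ideal.mem_comap, show (s * x) ^ (k + 1) = s ^ k * x * (s * x ^ k) by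
      ring]
    exact Ideal.mul_mem_left _ _ h
  have hunit : p.primeCompl ≤ (IsUnit.submonoid _).comap (θ.comp (algebraMap R C)) := fun s hs ↦
    IsLocalization.map_units (Localization M) (⟨_, s, hs, rfl⟩ : M)
  let ψ := Ideal.ResidueField.lift p _ hker hunit
  let := ψ.toAlgebra
  have hψ (r : R) : ψ (algebraMap R _ r) = θ (algebraMap R C r) :=
    Ideal.ResidueField.lift_algebraMap p _ hker hunit r
  have hrange {x : C} (hx : x ∈ (algebraMap R C).range) : θ x ∈ ψ.range := by
    obtain ⟨r, rfl⟩ := hx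
    exact ⟨_, hψ r⟩
  obtain ⟨k, hk⟩ := coeff_mem_range_of_mul_mem_lifts (K := p.ResidueField) (E := Localization M)
    (fun i ↦ (f i).map θ) (fun i ↦ (g i).map θ)
    (fun i j ↦ by
      rw [← Polynomial.map_mul, lifts_iff_coeff_lifts]
      intro k
      rw [coeff_map]
      exact hrange ((lifts_iff_coeff_lifts _).mp (hfg i j) k))
    (by simp_rw [← Polynomial.map_mul, ← Polynomial.map_sum, h1, Polynomial.map_one])
    (fun i ↦ by
      rw [coeff_map]
      exact hrange (hf i)) i n
  obtain ⟨a, s, rfl⟩ := IsLocalization.exists_mk'_eq (nonZeroDivisors (R ⧸ p)) k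
  obtain ⟨s, hs⟩ := s
  obtain ⟨a, rfl⟩ := Ideal.Quotient.mk_surjective a
  obtain ⟨s, rfl⟩ := Ideal.Quotient.mk_surjective s
  have hsp : s ∉ p := fun h ↦ nonZeroDivisors.ne_zero hs (Ideal.Quotient.eq_zero_iff_mem.mpr h)
  have hkey : θ (algebraMap R C s * (f i).coeff n - algebraMap R C a) = 0 := by
    have h := congr_arg ψ (IsLocalization.mk'_spec p.ResidueField (Ideal.Quotient.mk p a) ⟨_, hs⟩)
    rw [map_mul] at h
    have h2 : θ ((f i).coeff n) = _ := ((coeff_map θ n).symm.trans hk.symm)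
    rw [map_sub, map_mul, sub_eq_zero, ← hψ, ← hψ, h2, mul_comm]
    exact h
  obtain ⟨t, ht, h⟩ := hθ.mp hkey
  refine ⟨t * s, fun h ↦ (hp.isPrime.mem_or_mem h).elim ht hsp, ?_⟩
  have h3 := add_mem (h 1) ⟨t * a, rfl⟩
  rw [show algebraMap R C (t * s) * (f i).coeff n = algebraMap R C t *
    (algebraMap R C s * (f i).coeff n - algebraMap R C a) * 1 + algebraMap R C (t * a) by
      simp only [map_mul]; ring]
  exact h3

theorem Polynomial.algebraMap_surjective_of_mul_mem_lifts {ι R C : Type*} [Fintype ι]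
    [CommRing R] [CommRing C] [Algebra R C] (f g : ι → C[X])
    (hfg : ∀ i j, f i * g j ∈ lifts (algebraMap R C)) (h1 : ∑ i, f i * g i = 1)
    (hf : ∀ i, (f i).coeff 0 ∈ (algebraMap R C).range)
    (hg : ∀ i, (g i).coeff 0 ∈ (algebraMap R C).range)
    (hrad : (Algebra.conductorIdeal R C).IsRadical)
    (hgen : ∀ T : Subalgebra R C, (∀ i n, (f i).coeff n ∈ T) → (∀ i n, (g i).coeff n ∈ T) →
      T = ⊤) :
    Function.Surjective (algebraMap R C) := by
  have hsum : ∑ i, (f i).coeff 0 * (g i).coeff 0 = 1 := by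
    simpa [mul_coeff_zero, finsetSum_coeff] using congr_arg (coeff · 0) h1
  have hgf : ∀ i j, g i * f j ∈ lifts (algebraMap R C) := fun i j ↦ mul_comm (f j) (g i) ▸ hfg j i
  have h1' : ∑ i, g i * f i = 1 := by simpa only [mul_comm] using h1
  have hintf := isIntegral_coeff_of_family f g hfg hf hg hsum
  have hintg := isIntegral_coeff_of_family g f hgf hg hf (by simpa only [mul_comm] using hsum)
  have hfin : Module.Finite R C := by
    let s : Set C := ⋃ i, ((f i).coeffs : Set C) ∪ (g i).coeffs
    have hs : s.Finite := Set.finite_iUnion fun i ↦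
      ((f i).coeffs.finite_toSet).union ((g i).coeffs.finite_toSet)
    have hsi (i : ι) : ((f i).coeffs : Set C) ∪ (g i).coeffs ⊆ s :=
      Set.subset_iUnion (fun i ↦ ((f i).coeffs : Set C) ∪ (g i).coeffs) i
    have hmem {T : Subalgebra R C} {q : C[X]} (hq : (q.coeffs : Set C) ⊆ T) (n : ℕ) :
        q.coeff n ∈ T := by
      by_cases h : q.coeff n = 0
      · rw [h]; exact zero_mem T
      · exact hq (coeff_mem_coeffs h)
    have htop : Algebra.adjoin R s = ⊤ := hgen _
      (fun i ↦ hmem <| (Set.subset_union_left.trans (hsi i)).trans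
        Algebra.subset_adjoin)
      (fun i ↦ hmem <| (Set.subset_union_right.trans (hsi i)).trans
        Algebra.subset_adjoin)
    have := fg_adjoin_of_finite hs (R := R) fun x hx ↦ by
      obtain ⟨i, hx | hx⟩ := Set.mem_iUnion.mp hx
      · obtain ⟨n, -, rfl⟩ := mem_coeffs_iff.mp hx
        exact hintf i n
      · obtain ⟨n, -, rfl⟩ := mem_coeffs_iff.mp hx
        exact hintg i n
    rw [htop, Algebra.top_toSubmodule] at this
    exact ⟨this⟩
  by_contra hsurj
  obtain ⟨p, hp⟩ := Ideal.nonempty_minimalPrimes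
    (I := (Algebra.conductorIdeal R C).comap (algebraMap R C)) (by
      rw [Ne, Ideal.eq_top_iff_one, Ideal.mem_comap, map_one]
      exact fun h ↦ hsurj fun c ↦ by simpa using h c)
  have hpp := hp.isPrime
  let T : Subalgebra R C :=
    { carrier := {c | ∃ s ∉ p, algebraMap R C s * c ∈ (algebraMap R C).range}
      mul_mem' := by
        rintro a b ⟨s, hs, h⟩ ⟨t, ht, h'⟩
        refine ⟨s * t, fun h ↦ (hpp.mem_or_mem h).elim hs ht, ?_⟩
        rw [map_mul, mul_mul_mul_comm]
        exact mul_mem h h'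
      add_mem' := by
        rintro a b ⟨s, hs, h⟩ ⟨t, ht, h'⟩
        refine ⟨s * t, fun h ↦ (hpp.mem_or_mem h).elim hs ht, ?_⟩
        rw [map_mul, mul_add, mul_right_comm, mul_assoc _ _ b]
        exact add_mem (mul_mem h ⟨t, rfl⟩) (mul_mem ⟨s, rfl⟩ h')
      algebraMap_mem' := fun r ↦
        ⟨1, fun h ↦ hpp.ne_top ((Ideal.eq_top_iff_one _).mpr h), 1 * r, map_mul _ _ _⟩ }
  have hT : T = ⊤ := hgen T
    (exists_mul_coeff_mem_range_of_mem_minimalPrimes f g hfg h1 hf hrad hp)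
    (exists_mul_coeff_mem_range_of_mem_minimalPrimes g f hgf h1' hg hrad hp)
  have hTm (c : C) : ∃ s ∉ p, algebraMap R C s * c ∈ (algebraMap R C).range :=
    (hT ▸ Algebra.mem_top : c ∈ T)
  classical
  obtain ⟨S, hS⟩ := hfin.fg_top
  choose d hd hdr using hTm
  have hprod : ∏ c ∈ S, d c ∉ p := fun h ↦ by
    obtain ⟨c, -, h⟩ := (hpp.prod_mem_iff).mp h
    exact hd c h
  refine hprod (hp.1.2 ?_)
  rw [Ideal.mem_comap, Algebra.mem_conductorIdeal]
  intro c
  have hc : c ∈ Submodule.span R (S : Set C) := hS ▸ Submodule.mem_top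
  induction hc using Submodule.span_induction with
  | mem x hx =>
    rw [← Finset.prod_erase_mul _ _ hx, map_mul, mul_assoc]
    exact mul_mem ⟨_, rfl⟩ (hdr x)
  | zero => rw [mul_zero]; exact zero_mem _
  | add x y _ _ hx hy => rw [mul_add]; exact add_mem hx hy
  | smul r x _ hx =>
    rw [Algebra.smul_def, mul_left_comm]
    exact mul_mem ⟨r, rfl⟩ hx

theorem Module.exists_dual_pos_of_forall_nonneg {ι : Type*} (s : Finset ι) :
    ∀ (V : Type*) [AddCommGroup V] [Module ℚ V] (v : ι → V),
      (∀ a : ι → ℚ, (∀ i ∈ s, 0 ≤ a i) → ∑ i ∈ s, a i • v i = 0 → ∀ i ∈ s, a i = 0) →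
      ∃ φ : Module.Dual ℚ V, ∀ i ∈ s, 0 < φ (v i) := by
  classical
  induction s using Finset.induction_on with
  | empty => exact fun _ _ _ _ _ ↦ ⟨0, by simp⟩
  | insert j s hj ih =>
    intro V _ _ v H
    have H' (a : ι → ℚ) (t : ℚ) (ha : ∀ i ∈ s, 0 ≤ a i) (ht : 0 ≤ t)
        (h : t • v j + ∑ i ∈ s, a i • v i = 0) : t = 0 ∧ ∀ i ∈ s, a i = 0 := by
      have hne {i} (hi : i ∈ s) : i ≠ j := fun h ↦ hj (h ▸ hi)
      have := H (fun i ↦ if i = j then t else a i)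
        (by
          intro i hi
          split_ifs with h
          · exact ht
          · exact ha i ((Finset.mem_insert.mp hi).resolve_left h))
        (by
          rw [Finset.sum_insert hj, if_pos rfl, ← h]
          congr 1
          exact Finset.sum_congr rfl fun i hi ↦ by rw [if_neg (hne hi)])
      exact ⟨by simpa using this j (Finset.mem_insert_self _ _), fun i hi ↦ by
        simpa [hne hi] using this i (Finset.mem_insert_of_mem hi)⟩
    by_cases hq : ∀ a : ι → ℚ, (∀ i ∈ s, 0 ≤ a i) →
        ∑ i ∈ s, a i • (ℚ ∙ v j).mkQ (v i) = 0 → ∀ i ∈ s, a i = 0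
    · obtain ⟨φ, hφ⟩ := ih (V ⧸ (ℚ ∙ v j)) _ hq
      have hvj : v j ≠ 0 := fun h ↦ one_ne_zero (H' 0 1 (by simp) zero_le_one (by simp [h])).1
      obtain ⟨ψ, hψ⟩ : ∃ ψ : Module.Dual ℚ V, ψ (v j) ≠ 0 := by
        by_contra! h
        exact hvj ((Module.forall_dual_apply_eq_zero_iff ℚ _).mp h)
      obtain ⟨c, hc⟩ := (s.image fun i ↦
        1 - (ψ (v j))⁻¹ * ψ (v i) / φ ((ℚ ∙ v j).mkQ (v i))).exists_le
      refine ⟨c • φ ∘ₗ (ℚ ∙ v j).mkQ + (ψ (v j))⁻¹ • ψ, fun i hi ↦ ?_⟩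
      rcases Finset.mem_insert.mp hi with rfl | hi
      · have : (ℚ ∙ v i).mkQ (v i) = 0 := by simp
        simp [hψ, this, -Submodule.mkQ_apply]
      · have h1 := hc _ (Finset.mem_image_of_mem _ hi)
        have h2 := hφ i hi
        have h3 : (ψ (v j))⁻¹ * ψ (v i) / φ ((ℚ ∙ v j).mkQ (v i)) * φ ((ℚ ∙ v j).mkQ (v i)) =
          (ψ (v j))⁻¹ * ψ (v i) := div_mul_cancel₀ _ h2.ne'
        simp only [LinearMap.add_apply, LinearMap.smul_apply, LinearMap.comp_apply, smul_eq_mul]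
        nlinarith
    · push Not at hq
      obtain ⟨a, ha, h, k, hk, hak⟩ := hq
      obtain ⟨t, ht⟩ : ∃ t : ℚ, t • v j = ∑ i ∈ s, a i • v i := by
        rw [← Submodule.mem_span_singleton, ← Submodule.Quotient.mk_eq_zero,
          ← Submodule.mkQ_apply, map_sum]
        simpa only [map_smul] using h
      have ht0 : 0 < t := by
        by_contra! hn
        exact hak ((H' a (-t) ha (by linarith) (by rw [← ht]; simp)).2 k hk)
      obtain ⟨φ, hφ⟩ := ih V v fun b hb h ↦ (H' b 0 hb le_rfl (by simpa using h)).2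
      refine ⟨φ, fun i hi ↦ ?_⟩
      rcases Finset.mem_insert.mp hi with rfl | hi
      · have h1 := congr_arg φ ht
        rw [map_sum, map_smul, smul_eq_mul] at h1
        have h2 : 0 < ∑ i ∈ s, φ (a i • v i) := Finset.sum_pos' (fun i hi ↦ by
            rw [map_smul]; exact mul_nonneg (ha i hi) (hφ i hi).le)
          ⟨k, hk, by
            rw [map_smul]
            exact mul_pos ((ha k hk).lt_of_ne' hak) (hφ k hk)⟩
        rw [← h1] at h2
        exact (mul_pos_iff_of_pos_left ht0).mp h2
      · exact hφ i hi

theorem Module.exists_dual_pos_and_ne_zero {ι V : Type*} [AddCommGroup V] [Module ℚ V]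
    (s : Finset ι) (v : ι → V)
    (H : ∀ a : ι → ℚ, (∀ i ∈ s, 0 ≤ a i) → ∑ i ∈ s, a i • v i = 0 → ∀ i ∈ s, a i = 0)
    (D : Finset V) (hD : ∀ d ∈ D, d ≠ 0) :
    ∃ φ : Module.Dual ℚ V, (∀ i ∈ s, 0 < φ (v i)) ∧ ∀ d ∈ D, φ d ≠ 0 := by
  classical
  obtain ⟨φ, hφ⟩ := exists_dual_pos_of_forall_nonneg s V v H
  obtain ⟨ψ, hψ⟩ := exists_dual_forall_apply_ne_zero (K := ℚ) (fun d : D ↦ (d : V))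
    fun d ↦ hD _ d.2
  obtain ⟨c, hc⟩ := ((s.image v ∪ D).image fun x ↦ 1 - ψ x / φ x).exists_le
  have hc' (x) (hx : x ∈ s.image v ∪ D) : 1 - ψ x / φ x ≤ c :=
    hc _ (Finset.mem_image_of_mem _ hx)
  refine ⟨c • φ + ψ, fun i hi ↦ ?_, fun d hd h ↦ ?_⟩
  · have h1 := hc' _ (Finset.mem_union_left _ (Finset.mem_image_of_mem v hi))
    have h2 := hφ i hi
    have h3 : ψ (v i) / φ (v i) * φ (v i) = ψ (v i) := div_mul_cancel₀ _ h2.ne'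
    simp only [LinearMap.add_apply, LinearMap.smul_apply, smul_eq_mul]
    nlinarith
  · have h1 := hc' _ (Finset.mem_union_right _ hd)
    simp only [LinearMap.add_apply, LinearMap.smul_apply, smul_eq_mul] at h
    by_cases h0 : φ d = 0
    · exact hψ ⟨d, hd⟩ (by simpa [h0] using h)
    · rw [eq_neg_of_add_eq_zero_right h, neg_div, mul_div_cancel_right₀ _ h0] at h1
      linarith

universe u in
theorem CancelCommMonoid.exists_injective_addMonoidHom_module_rat {N : Type u} [CancelCommMonoid N]
    [IsMulTorsionFree N] :
    ∃ (V : Type u) (_ : AddCommGroup V) (_ : Module ℚ V) (j : Additive N →+ V),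
      Function.Injective j := by
  have hinj := Algebra.GrothendieckGroup.of_injective (M := N)
  have : IsMulTorsionFree (Algebra.GrothendieckGroup N) := by
    refine ⟨fun n hn x y h ↦ ?_⟩
    obtain ⟨⟨a, s⟩, rfl⟩ := Localization.mkHom_surjective x
    obtain ⟨⟨b, t⟩, rfl⟩ := Localization.mkHom_surjective y
    simp only [Localization.mkHom_apply, Localization.mk_pow, Localization.mk_eq_mk_iff,
      Localization.r_iff_exists] at h ⊢
    obtain ⟨c, hc⟩ := h
    refine ⟨1, ?_⟩
    simp only [OneMemClass.coe_one, one_mul, SubmonoidClass.coe_pow, mul_right_inj] at hc ⊢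
    rw [← mul_pow, ← mul_pow] at hc
    exact pow_left_injective hn hc
  refine ⟨DivisibleHull (Additive (Algebra.GrothendieckGroup N)), inferInstance, inferInstance,
    (DivisibleHull.coeAddMonoidHom _).comp
      (MonoidHom.toAdditive (Algebra.GrothendieckGroup.of (M := N))),
      DivisibleHull.coe_injective.comp hinj⟩

theorem Rat.exists_natCast_mul_eq {ι : Type*} (s : Finset ι) (a : ι → ℚ)
    (ha : ∀ i ∈ s, 0 ≤ a i) : ∃ d : ℕ, d ≠ 0 ∧ ∃ b : ι → ℕ, ∀ i ∈ s, (d : ℚ) * a i = b i := by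
  classical
  refine ⟨∏ i ∈ s, (a i).den, Finset.prod_ne_zero_iff.mpr fun i _ ↦ (a i).den_ne_zero,
    fun i ↦ (∏ k ∈ s.erase i, (a k).den) * (a i).num.toNat, fun i hi ↦ ?_⟩
  have h : (((a i).num.toNat : ℕ) : ℚ) = (a i).num := by
    exact_mod_cast Int.toNat_of_nonneg (Rat.num_nonneg.mpr (ha i hi))
  rw [← Finset.prod_erase_mul _ _ hi, Nat.cast_mul, Nat.cast_mul, mul_assoc, h,
    Rat.den_mul_eq_num]

theorem IsPositiveMonoid.exists_addMonoidHom_rat {N : Type*} [CancelCommMonoid N]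
    [IsMulTorsionFree N] (hpos : IsPositiveMonoid N) (F : Finset N) :
    ∃ (φ : Additive N →+ ℚ) (k : N → ℕ), (∀ n ∈ F, φ (.ofMul n) = k n) ∧
      (∀ n ∈ F, n ≠ 1 → k n ≠ 0) ∧ Set.InjOn k F := by
  classical
  obtain ⟨V, _, _, j, hj⟩ := CancelCommMonoid.exists_injective_addMonoidHom_module_rat (N := N)
  set v : N → V := fun n ↦ j (.ofMul n)
  have hv : Function.Injective v := hj
  obtain ⟨φ, hφ, hφ'⟩ := Module.exists_dual_pos_and_ne_zero (F.erase 1) v (by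
    intro a ha h n hn
    obtain ⟨d, hd, b, hb⟩ := Rat.exists_natCast_mul_eq _ a ha
    have h1 : j (.ofMul (∏ n ∈ F.erase 1, n ^ b n)) = 0 := by
      rw [ofMul_prod, map_sum, ← smul_zero (d : ℚ), ← h, Finset.smul_sum]
      refine Finset.sum_congr rfl fun m hm ↦ ?_
      rw [smul_smul, hb m hm, ofMul_pow, map_nsmul, Nat.cast_smul_eq_nsmul]
    have h2 : ∏ n ∈ F.erase 1, n ^ b n = 1 := hj (h1.trans (map_zero j).symm)
    have h3 : IsUnit (n ^ b n) :=
      isUnit_of_dvd_one (h2 ▸ Finset.dvd_prod_of_mem (fun n ↦ n ^ b n) hn)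
    have hbn : b n = 0 := by
      by_contra h0
      exact Finset.ne_of_mem_erase hn (hpos n ((isUnit_pow_iff h0).mp h3))
    have := hb n hn
    rw [hbn, Nat.cast_zero] at this
    exact (mul_eq_zero.mp this).resolve_left (Nat.cast_ne_zero.mpr hd))
    ((F ×ˢ F).image (fun p ↦ v p.1 - v p.2) |>.erase 0) fun d hd ↦ Finset.ne_of_mem_erase hd
  have hφ0 (n) (hn : n ∈ F) : 0 ≤ φ (v n) := by
    by_cases h : n = 1
    · simp [h, v]
    · exact (hφ n (Finset.mem_erase.mpr ⟨h, hn⟩)).le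
  obtain ⟨d, hd, b, hb⟩ := Rat.exists_natCast_mul_eq F (fun n ↦ φ (v n)) hφ0
  refine ⟨((d : ℚ) • φ).toAddMonoidHom.comp j, b, hb, fun n hn h h0 ↦ ?_, fun n hn m hm h ↦ ?_⟩
  · have h1 := hb n hn
    have h2 := hφ n (Finset.mem_erase.mpr ⟨h, hn⟩)
    rw [h0, Nat.cast_zero] at h1
    exact (mul_ne_zero (Nat.cast_ne_zero.mpr hd) h2.ne') h1
  · by_contra hne
    have h1 := (hb n hn).trans ((congr_arg Nat.cast h).trans (hb m hm).symm)
    refine hφ' (v n - v m) (Finset.mem_erase.mpr ⟨sub_ne_zero.mpr (hv.ne hne),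
      Finset.mem_image.mpr ⟨(n, m), Finset.mk_mem_product hn hm, rfl⟩⟩) ?_
    rw [map_sub, sub_eq_zero]
    exact mul_left_cancel₀ (Nat.cast_ne_zero.mpr hd) h1

theorem CancelCommMonoid.uniqueProds {N : Type*} [CancelCommMonoid N] [IsMulTorsionFree N] :
    UniqueProds N := by
  obtain ⟨V, _, _, j, hj⟩ := CancelCommMonoid.exists_injective_addMonoidHom_module_rat (N := N)
  exact UniqueProds.of_injective_mulHom (AddMonoidHom.toMultiplicativeRight j).toMulHom hj
    inferInstance

namespace MonoidAlgebra
variable {B N : Type*} [CommRing B]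

theorem sum_single_coeff (x : MonoidAlgebra B N) :
    ∑ n ∈ x.coeff.support, single n (x.coeff n) = x :=
  sum_coeff_single x

theorem sum_single_coeff_of_subset {x : MonoidAlgebra B N} {F : Finset N}
    (h : x.coeff.support ⊆ F) : ∑ n ∈ F, single n (x.coeff n) = x := by
  conv_rhs => rw [← sum_single_coeff x]
  refine (Finset.sum_subset h fun n _ hn ↦ ?_).symm
  rw [Finsupp.notMem_support_iff.mp hn, single_zero]

variable [CommMonoid N]

/-- The largest subring of `C` containing the homogeneous components of all its elements. -/
def homogeneousCore (C : Subring (MonoidAlgebra B N)) : Subring (MonoidAlgebra B N) where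
  carrier := {x | ∀ n, single n (x.coeff n) ∈ C}
  mul_mem' {x y} hx hy n := by
    change (x * y).coeff n ∈ C.toAddSubgroup.comap (singleAddHom n)
    rw [coeff_mul]
    refine sum_mem fun m₁ _ ↦ sum_mem fun m₂ _ ↦ ?_
    dsimp only
    split_ifs with h
    · change single n (x.coeff m₁ * y.coeff m₂) ∈ C
      rw [← h, ← single_mul_single]
      exact mul_mem (hx m₁) (hy m₂)
    · exact zero_mem _
  one_mem' n := by
    by_cases h : n = 1
    · rw [h, coeff_one_one]
      exact one_mem C
    · rw [one_def, coeff_single, Finsupp.single_eq_of_ne h, single_zero]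
      exact zero_mem C
  add_mem' {x y} hx hy n := by
    rw [coeff_add, Finsupp.add_apply, single_add]
    exact add_mem (hx n) (hy n)
  zero_mem' n := by
    rw [coeff_zero, Finsupp.zero_apply, single_zero]
    exact zero_mem C
  neg_mem' {x} hx n := by
    rw [coeff_neg, Finsupp.neg_apply, single_neg]
    exact neg_mem (hx n)

theorem mem_homogeneousCore {C : Subring (MonoidAlgebra B N)} {x : MonoidAlgebra B N} :
    x ∈ homogeneousCore C ↔ ∀ n, single n (x.coeff n) ∈ C := Iff.rfl

theorem mem_of_forall_single_mem {C : Subring (MonoidAlgebra B N)} {x : MonoidAlgebra B N}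
    (h : ∀ n, single n (x.coeff n) ∈ C) : x ∈ C := by
  rw [← sum_single_coeff x]
  exact sum_mem fun n _ ↦ h n

theorem single_mem_homogeneousCore {C : Subring (MonoidAlgebra B N)} {n : N} {b : B}
    (h : single n b ∈ C) : single n b ∈ homogeneousCore C := fun m ↦ by
  by_cases hm : m = n
  · rw [hm, coeff_single, Finsupp.single_eq_same]
    exact h
  · rw [coeff_single, Finsupp.single_eq_of_ne hm, single_zero]
    exact zero_mem C

theorem monoidAlgebraSubring_le_homogeneousCore (A : Subring B) (M : Submonoid N) :
    monoidAlgebraSubring A M ≤ homogeneousCore (monoidAlgebraSubring A M) := by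
  refine Subring.closure_le.mpr ?_
  rintro x ⟨a, ha, m, hm, rfl⟩
  exact single_mem_homogeneousCore (Subring.subset_closure ⟨a, ha, m, hm, rfl⟩)

theorem coeff_mem_of_mem_monoidAlgebraSubring {A : Subring B} {M : Submonoid N}
    {x : MonoidAlgebra B N} (hx : x ∈ monoidAlgebraSubring A M) (n : N) :
    x.coeff n ∈ A ∧ (x.coeff n ≠ 0 → n ∈ M) := by
  let G (n : N) : AddSubgroup B := if n ∈ M then A.toAddSubgroup else ⊥
  have hG {n : N} {b : B} : b ∈ G n ↔ b ∈ A ∧ (b ≠ 0 → n ∈ M) := by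
    by_cases h : n ∈ M
    · simp [G, h]
    · simp only [G, h, if_false, AddSubgroup.mem_bot, imp_false, not_not]
      exact ⟨fun hb ↦ ⟨hb ▸ zero_mem A, hb⟩, And.right⟩
  rw [← hG]
  induction hx using Subring.closure_induction generalizing n with
  | mem x hx =>
    obtain ⟨a, ha, m, hm, rfl⟩ := hx
    by_cases h : n = m
    · rw [h, coeff_single, Finsupp.single_eq_same, hG]
      exact ⟨ha, fun _ ↦ hm⟩
    · rw [coeff_single, Finsupp.single_eq_of_ne h]
      exact zero_mem _
  | zero => exact zero_mem _
  | one =>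
    by_cases h : n = 1
    · rw [h, coeff_one_one, hG]
      exact ⟨one_mem A, fun _ ↦ one_mem M⟩
    · rw [one_def, coeff_single, Finsupp.single_eq_of_ne h]
      exact zero_mem _
  | add x y _ _ hx hy => exact add_mem (hx n) (hy n)
  | neg x _ hx => exact neg_mem (hx n)
  | mul x y _ _ hx hy =>
    rw [coeff_mul]
    refine sum_mem fun m₁ _ ↦ sum_mem fun m₂ _ ↦ ?_
    dsimp only
    split_ifs with h
    · have h₁ := hG.mp (hx m₁)
      have h₂ := hG.mp (hy m₂)
      exact hG.mpr ⟨mul_mem h₁.1 h₂.1, fun h0 ↦ h ▸ mul_mem (h₁.2 (left_ne_zero_of_mul h0))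
        (h₂.2 (right_ne_zero_of_mul h0))⟩
    · exact zero_mem _

theorem single_mem_monoidAlgebraSubring_iff {A : Subring B} {M : Submonoid N} {n : N} {b : B} :
    single n b ∈ monoidAlgebraSubring A M ↔ b ∈ A ∧ (b ≠ 0 → n ∈ M) := by
  refine ⟨fun h ↦ by simpa using coeff_mem_of_mem_monoidAlgebraSubring h n, fun ⟨h, h'⟩ ↦ ?_⟩
  by_cases hb : b = 0
  · rw [hb, single_zero]
    exact zero_mem _
  · exact Subring.subset_closure ⟨b, h, n, h' hb, rfl⟩

theorem single_mem_monoidAlgebraSubring_of_sq_of_cube [IsReduced B] {A : Subring B}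
    {M : Submonoid N} (hA : A.IsSubintegrallyClosedIn) (hM : M.IsSubintegrallyClosedIn)
    {n : N} {b : B} (h2 : single n b ^ 2 ∈ monoidAlgebraSubring A M)
    (h3 : single n b ^ 3 ∈ monoidAlgebraSubring A M) :
    single n b ∈ monoidAlgebraSubring A M := by
  rw [single_pow, single_mem_monoidAlgebraSubring_iff] at h2 h3
  exact single_mem_monoidAlgebraSubring_iff.mpr ⟨hA b h2.1 h3.1, fun hb ↦
    hM n (h2.2 (pow_ne_zero 2 hb)) (h3.2 (pow_ne_zero 3 hb))⟩

end MonoidAlgebra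

namespace MonoidAlgebra
variable {B N : Type*} [CommRing B] [CancelCommMonoid N]

theorem isRadical_of_homogeneous [UniqueProds N] {C : Subring (MonoidAlgebra B N)}
    (hC : C ≤ homogeneousCore C) (I : Ideal C)
    (hI : ∀ x ∈ I, ∀ n, (⟨single n ((x : MonoidAlgebra B N).coeff n), hC x.2 n⟩ : C) ∈ I)
    (hI' : ∀ n b, ∀ h : single n b ∈ C, (⟨single n b, h⟩ : C) ^ 2 ∈ I → (⟨single n b, h⟩ : C) ∈ I) :
    I.IsRadical := by
  rw [Ideal.isRadical_iff_pow_one_lt 2 one_lt_two]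
  intro x
  induction hk : (x : MonoidAlgebra B N).coeff.support.card using Nat.strong_induction_on
    generalizing x with
  | _ k ih =>
    intro hx
    by_cases hx0 : x = 0
    · rw [hx0]
      exact zero_mem I
    have hne : (x : MonoidAlgebra B N).coeff.support.Nonempty := by
      rw [Finsupp.support_nonempty_iff, Ne, coeff_eq_zero]
      exact fun h ↦ hx0 (Subtype.ext h)
    obtain ⟨a, ha, b, hb, hu⟩ := UniqueProds.uniqueMul_of_nonempty hne hne
    obtain rfl : b = a := (hu hb ha (mul_comm b a)).1
    set s : C := ⟨single b ((x : MonoidAlgebra B N).coeff b), hC x.2 b⟩ with hs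
    have hsI : s ∈ I := hI' _ _ _ <| by
      convert hI _ hx (b * b) using 1
      refine Subtype.ext ?_
      change single b ((x : MonoidAlgebra B N).coeff b) ^ 2 =
        single (b * b) (((x : MonoidAlgebra B N) ^ 2).coeff (b * b))
      rw [sq, sq, single_mul_single, coeff_mul_mul_of_uniqueMul hu]
    have hxs : x - s ∈ I := by
      refine ih _ ?_ _ rfl ?_
      · rw [← hk]
        have hxs : ((x - s : C) : MonoidAlgebra B N) = (x : MonoidAlgebra B N).erase b := by
          rw [AddSubgroupClass.coe_sub, sub_eq_iff_eq_add', single_add_erase]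
        rw [hxs, coeff_erase, Finsupp.support_erase]
        exact Finset.card_erase_lt_of_mem hb
      · rw [show (x - s) ^ 2 = x ^ 2 - (2 * x - s) * s by ring]
        exact sub_mem hx (I.mul_mem_left _ hsI)
    simpa using add_mem hxs hsI

theorem isRadical_conductorIdeal [IsReduced B] [UniqueProds N] {A : Subring B} {M : Submonoid N}
    (hA : A.IsSubintegrallyClosedIn) (hM : M.IsSubintegrallyClosedIn)
    (C : Subalgebra (monoidAlgebraSubring A M) (MonoidAlgebra B N))
    (hC : C.toSubring ≤ homogeneousCore C.toSubring) :
    (Algebra.conductorIdeal (monoidAlgebraSubring A M) C).IsRadical := by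
  have hmem {x : C} : x ∈ (algebraMap (monoidAlgebraSubring A M) C).range ↔
      (x : MonoidAlgebra B N) ∈ monoidAlgebraSubring A M :=
    ⟨by rintro ⟨r, rfl⟩; exact r.2, fun h ↦ ⟨⟨_, h⟩, rfl⟩⟩
  have hcond {x : C} (h : ∀ m c, single m c ∈ C →
      (x : MonoidAlgebra B N) * single m c ∈ monoidAlgebraSubring A M) :
      x ∈ Algebra.conductorIdeal (monoidAlgebraSubring A M) C := fun y ↦ by
    rw [hmem, MulMemClass.coe_mul, ← sum_single_coeff (y : MonoidAlgebra B N), Finset.mul_sum]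
    exact sum_mem fun m _ ↦ h m _ (hC y.2 m)
  refine isRadical_of_homogeneous (C := C.toSubring) hC _ (fun x hx n ↦ hcond fun m c hc ↦ ?_)
    fun n b h hx ↦ hcond fun m c hc ↦ ?_
  · have := monoidAlgebraSubring_le_homogeneousCore A M (hmem.mp (hx ⟨_, hc⟩)) (n * m)
    rw [MulMemClass.coe_mul, coeff_mul_single_eq_coeff_mul n (by simp)] at this
    rwa [single_mul_single]
  · have key {y : MonoidAlgebra B N} (hy : y ∈ C) :
        single n b ^ 2 * y ∈ monoidAlgebraSubring A M := by
      have := hmem.mp (hx ⟨y, hy⟩)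
      rwa [MulMemClass.coe_mul, SubmonoidClass.coe_pow] at this
    rw [single_mul_single]
    refine single_mem_monoidAlgebraSubring_of_sq_of_cube hA hM ?_ ?_
    · rw [← single_mul_single, mul_pow]
      exact key (pow_mem hc 2)
    · rw [← single_mul_single, show (single n b * single m c) ^ 3 = single n b ^ 2 *
        (single n b * single m c ^ 3) by ring]
      exact key (mul_mem h (pow_mem hc 3))

end MonoidAlgebra

namespace MonoidAlgebra
variable {B N : Type*} [CommRing B] [CommMonoid N]

/-- The ring homomorphism recording the `ℚ`-grading of `B[N]` defined by `φ`. -/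
def gradingHom (φ : Additive N →+ ℚ) :
    MonoidAlgebra B N →+* AddMonoidAlgebra (MonoidAlgebra B N) ℚ :=
  (lift B (AddMonoidAlgebra (MonoidAlgebra B N) ℚ) N
    { toFun := fun n ↦ AddMonoidAlgebra.single (φ (.ofMul n)) (single n 1)
      map_one' := by rw [ofMul_one, map_zero]; rfl
      map_mul' := fun m n ↦ by
        rw [ofMul_mul, map_add, AddMonoidAlgebra.single_mul_single, single_mul_single,
          one_mul] }).toRingHom

theorem gradingHom_single (φ : Additive N →+ ℚ) (n : N) (b : B) :
    gradingHom φ (single n b) = AddMonoidAlgebra.single (φ (.ofMul n)) (single n b) := by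
  refine (lift_single _ n b).trans ?_
  rw [MonoidHom.coe_mk, OneHom.coe_mk, AddMonoidAlgebra.smul_single, smul_single', mul_one]

theorem coeff_gradingHom_mem {R : Subring (MonoidAlgebra B N)} (φ : Additive N →+ ℚ)
    {x : MonoidAlgebra B N} (hx : x ∈ homogeneousCore R) (q : ℚ) :
    (gradingHom φ x).coeff q ∈ R := by
  rw [← sum_single_coeff x, map_sum, AddMonoidAlgebra.coeff_sum, Finsupp.finsetSum_apply]
  refine sum_mem fun n _ ↦ ?_
  rw [gradingHom_single, AddMonoidAlgebra.coeff_single, Finsupp.single_apply]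
  split_ifs
  · exact hx n
  · exact zero_mem R

/-- The embedding of polynomials into the monoid algebra of `ℚ`, after a base change. -/
def _root_.Polynomial.toAddMonoidAlgebraRat {C S : Type*} [CommRing C] [CommRing S] (ι : C →+* S) :
    C[X] →+* AddMonoidAlgebra S ℚ :=
  eval₂RingHom (AddMonoidAlgebra.singleZeroRingHom.comp ι) (AddMonoidAlgebra.single 1 1)

theorem _root_.Polynomial.toAddMonoidAlgebraRat_monomial {C S : Type*} [CommRing C] [CommRing S]
    (ι : C →+* S) (n : ℕ) (c : C) :
    toAddMonoidAlgebraRat ι (monomial n c) = AddMonoidAlgebra.single (n : ℚ) (ι c) := by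
  simp [toAddMonoidAlgebraRat, AddMonoidAlgebra.single_pow, AddMonoidAlgebra.single_mul_single,
    eval₂_monomial]

theorem _root_.Polynomial.coeff_toAddMonoidAlgebraRat {C S : Type*} [CommRing C] [CommRing S]
    (ι : C →+* S) (p : C[X]) (n : ℕ) :
    (toAddMonoidAlgebraRat ι p).coeff n = ι (p.coeff n) := by
  induction p using Polynomial.induction_on' with
  | add p q hp hq =>
    rw [map_add, AddMonoidAlgebra.coeff_add, Finsupp.add_apply, hp, hq, Polynomial.coeff_add,
      map_add]
  | monomial m c =>
    rw [toAddMonoidAlgebraRat_monomial, AddMonoidAlgebra.coeff_single, Finsupp.single_apply,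
      coeff_monomial]
    split_ifs <;> simp_all

theorem _root_.Polynomial.toAddMonoidAlgebraRat_injective {C S : Type*} [CommRing C] [CommRing S]
    {ι : C →+* S} (hι : Function.Injective ι) : Function.Injective (toAddMonoidAlgebraRat ι) :=
  fun p q h ↦ Polynomial.ext fun n ↦ hι <| by
    rw [← coeff_toAddMonoidAlgebraRat, ← coeff_toAddMonoidAlgebraRat, h]

/-- The polynomial over `C` obtained from `x`, whose homogeneous components are in `C`, by placing
its component of degree `n` in degree `k n`. -/
def gradedPolynomial (C : Subring (MonoidAlgebra B N)) (F : Finset N) (k : N → ℕ)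
    (x : homogeneousCore C) : C[X] :=
  ∑ n ∈ F, monomial (k n) ⟨single n ((x : MonoidAlgebra B N).coeff n), x.2 n⟩

variable {C : Subring (MonoidAlgebra B N)} {F : Finset N} {k : N → ℕ}

theorem coeff_gradedPolynomial (hk : Set.InjOn k F) (x : homogeneousCore C) {n : N} (hn : n ∈ F) :
    ((gradedPolynomial C F k x).coeff (k n) : MonoidAlgebra B N) =
      single n ((x : MonoidAlgebra B N).coeff n) := by
  rw [gradedPolynomial, finsetSum_coeff, Finset.sum_eq_single_of_mem n hn, coeff_monomial_same]
  exact fun m hm hmn ↦ coeff_monomial_of_ne _ fun h ↦ hmn (hk hm hn h.symm)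

theorem coeff_zero_gradedPolynomial (hk : ∀ n ∈ F, n ≠ 1 → k n ≠ 0) (x : homogeneousCore C)
    (R : Subring (MonoidAlgebra B N)) (hx : single 1 ((x : MonoidAlgebra B N).coeff 1) ∈ R) :
    ((gradedPolynomial C F k x).coeff 0 : MonoidAlgebra B N) ∈ R := by
  rw [gradedPolynomial, finsetSum_coeff, AddSubmonoidClass.coe_finsetSum]
  refine sum_mem fun n hn ↦ ?_
  rw [coeff_monomial]
  split_ifs with h
  · obtain rfl : n = 1 := by
      by_contra h1
      exact hk n hn h1 h
    exact hx
  · exact zero_mem R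

theorem toAddMonoidAlgebraRat_gradedPolynomial {φ : Additive N →+ ℚ}
    (hφ : ∀ n ∈ F, φ (.ofMul n) = k n) {x : homogeneousCore C}
    (hx : (x : MonoidAlgebra B N).coeff.support ⊆ F) :
    toAddMonoidAlgebraRat C.subtype (gradedPolynomial C F k x) =
      gradingHom φ (x : MonoidAlgebra B N) := by
  conv_rhs => rw [← sum_single_coeff_of_subset hx, map_sum]
  rw [gradedPolynomial, map_sum]
  refine Finset.sum_congr rfl fun n hn ↦ ?_
  rw [toAddMonoidAlgebraRat_monomial, gradingHom_single, hφ n hn]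
  rfl

end MonoidAlgebra

namespace MonoidAlgebra
variable {B N : Type*} [CommRing B] [IsReduced B] [CancelCommMonoid N] [IsMulTorsionFree N]

theorem mem_monoidAlgebraSubring_of_mul_mem {ι : Type*} [Fintype ι] {A : Subring B}
    {M : Submonoid N} (hpos : IsPositiveMonoid N) (hA : A.IsSubintegrallyClosedIn)
    (hM : M.IsSubintegrallyClosedIn) (f g : ι → MonoidAlgebra B N)
    (hfg : ∀ i j, f i * g j ∈ monoidAlgebraSubring A M) (h1 : ∑ i, f i * g i = 1)
    (hf : ∀ i, (f i).coeff 1 ∈ A) (hg : ∀ i, (g i).coeff 1 ∈ A) (i : ι) :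
    f i ∈ monoidAlgebraSubring A M ∧ g i ∈ monoidAlgebraSubring A M := by
  have := CancelCommMonoid.uniqueProds (N := N)
  set R := monoidAlgebraSubring A M
  let F : Finset N := Finset.univ.biUnion fun i ↦ (f i).coeff.support ∪ (g i).coeff.support
  have hFf (i) : (f i).coeff.support ⊆ F := Finset.subset_union_left.trans
    (Finset.subset_biUnion_of_mem (fun i ↦ (f i).coeff.support ∪ (g i).coeff.support)
      (Finset.mem_univ i))
  have hFg (i) : (g i).coeff.support ⊆ F := Finset.subset_union_right.trans
    (Finset.subset_biUnion_of_mem (fun i ↦ (f i).coeff.support ∪ (g i).coeff.support)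
      (Finset.mem_univ i))
  obtain ⟨φ, k, hφ, hk0, hk⟩ := hpos.exists_addMonoidHom_rat F
  let T : Set (MonoidAlgebra B N) :=
    {x | ∃ i, ∃ n, x = single n ((f i).coeff n) ∨ x = single n ((g i).coeff n)}
  let C : Subalgebra R (MonoidAlgebra B N) := Algebra.adjoin R T
  have hC : C.toSubring ≤ homogeneousCore C.toSubring := fun x hx ↦ by
    induction hx using Algebra.adjoin_induction with
    | mem x hx =>
      have hxC : x ∈ C.toSubring := Algebra.subset_adjoin hx
      obtain ⟨i, n, rfl | rfl⟩ := hx <;> exact single_mem_homogeneousCore hxC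
    | algebraMap r => exact fun n ↦
        C.algebraMap_mem ⟨_, monoidAlgebraSubring_le_homogeneousCore A M r.2 n⟩
    | add x y _ _ hx hy => exact add_mem hx hy
    | mul x y _ _ hx hy => exact mul_mem hx hy
  have hfC (i) (n) : single n ((f i).coeff n) ∈ C := Algebra.subset_adjoin ⟨i, n, .inl rfl⟩
  have hgC (i) (n) : single n ((g i).coeff n) ∈ C := Algebra.subset_adjoin ⟨i, n, .inr rfl⟩
  let P (i) : C[X] := gradedPolynomial C.toSubring F k ⟨f i, hfC i⟩
  let Q (i) : C[X] := gradedPolynomial C.toSubring F k ⟨g i, hgC i⟩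
  let Ψ : C[X] →+* AddMonoidAlgebra (MonoidAlgebra B N) ℚ :=
    toAddMonoidAlgebraRat C.toSubring.subtype
  have hP (i) : Ψ (P i) = gradingHom φ (f i) := toAddMonoidAlgebraRat_gradedPolynomial hφ (hFf i)
  have hQ (i) : Ψ (Q i) = gradingHom φ (g i) := toAddMonoidAlgebraRat_gradedPolynomial hφ (hFg i)
  have hmem {x : C} : x ∈ (algebraMap R C).range ↔ (x : MonoidAlgebra B N) ∈ R :=
    ⟨by rintro ⟨r, rfl⟩; exact r.2, fun h ↦ ⟨⟨_, h⟩, rfl⟩⟩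
  have hR {b : B} (hb : b ∈ A) : single (1 : N) b ∈ R :=
    single_mem_monoidAlgebraSubring_iff.mpr ⟨hb, fun _ ↦ one_mem M⟩
  have hsurj := Polynomial.algebraMap_surjective_of_mul_mem_lifts P Q
    (fun i j ↦ by
      rw [lifts_iff_coeff_lifts]
      intro l
      refine hmem.mpr ?_
      have h := coeff_toAddMonoidAlgebraRat C.toSubring.subtype (P i * Q j) l
      have h' : Ψ (P i * Q j) = gradingHom φ (f i * g j) := by rw [map_mul, map_mul, hP, hQ]
      have h'' := coeff_gradingHom_mem φ
        (monoidAlgebraSubring_le_homogeneousCore A M (hfg i j)) l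
      rw [← h', h] at h''
      exact h'')
    (toAddMonoidAlgebraRat_injective C.toSubring.subtype_injective (by
      change Ψ _ = Ψ 1
      rw [map_one, map_sum, ← map_one (gradingHom φ), ← h1, map_sum]
      simp_rw [map_mul, hP, hQ]))
    (fun i ↦ hmem.mpr (coeff_zero_gradedPolynomial hk0 _ R (hR (hf i))))
    (fun i ↦ hmem.mpr (coeff_zero_gradedPolynomial hk0 _ R (hR (hg i))))
    (isRadical_conductorIdeal hA hM C hC)
    (fun T' hPT hQT ↦ by
      refine top_unique ?_
      rw [← Algebra.adjoin_adjoin_coe_preimage (R := R) (s := T), Algebra.adjoin_le_iff]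
      rintro ⟨x, hxC⟩ ⟨i, n, hx⟩
      dsimp only at hx
      by_cases hn : n ∈ F
      · rcases hx with rfl | rfl
        · have h : (P i).coeff (k n) = ⟨_, hxC⟩ := Subtype.ext
            (coeff_gradedPolynomial (C := C.toSubring) hk ⟨f i, hfC i⟩ hn)
          exact h ▸ hPT i (k n)
        · have h : (Q i).coeff (k n) = ⟨_, hxC⟩ := Subtype.ext
            (coeff_gradedPolynomial (C := C.toSubring) hk ⟨g i, hgC i⟩ hn)
          exact h ▸ hQT i (k n)
      · have hx0 : x = 0 := by
          rcases hx with rfl | rfl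
          · rw [Finsupp.notMem_support_iff.mp fun h ↦ hn (hFf i h), single_zero]
          · rw [Finsupp.notMem_support_iff.mp fun h ↦ hn (hFg i h), single_zero]
        subst hx0
        exact zero_mem T')
  have hCR {x : MonoidAlgebra B N} (hx : x ∈ C) : x ∈ R := hmem.mp (hsurj ⟨x, hx⟩)
  exact ⟨mem_of_forall_single_mem fun n ↦ hCR (hfC i n),
    mem_of_forall_single_mem fun n ↦ hCR (hgC i n)⟩

end MonoidAlgebra

/-- The extension of submodules along a ring homomorphism `h` with `h R ⊆ R'`. -/
def Submodule.spanImage {S S' : Type*} [CommRing S] [CommRing S'] (h : S →+* S') (R : Subring S)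
    (R' : Subring S') (hR : ∀ r ∈ R, h r ∈ R') : Submodule R S →* Submodule R' S' where
  toFun I := span R' (h '' I)
  map_one' := by
    refine le_antisymm (span_le.mpr ?_) (one_le.mpr (subset_span ⟨1, one_le.mp le_rfl, map_one h⟩))
    rintro _ ⟨x, hx, rfl⟩
    obtain ⟨r, rfl⟩ := mem_one.mp hx
    exact mem_one.mpr ⟨⟨h r, hR r r.2⟩, rfl⟩
  map_mul' I J := by
    rw [span_mul_span]
    refine le_antisymm (span_le.mpr ?_) (span_mono ?_)
    · rintro _ ⟨x, hx, rfl⟩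
      induction hx using Submodule.mul_induction_on' with
      | mem_mul_mem x hx y hy =>
        exact subset_span ⟨h x, ⟨x, hx, rfl⟩, h y, ⟨y, hy, rfl⟩, (map_mul h x y).symm⟩
      | add x _ y _ hx hy => rw [map_add]; exact add_mem hx hy
    · rintro _ ⟨_, ⟨x, hx, rfl⟩, _, ⟨y, hy, rfl⟩, rfl⟩
      exact ⟨x * y, mul_mem_mul hx hy, map_mul h x y⟩

theorem Submodule.coe_spanImage {S S' : Type*} [CommRing S] [CommRing S'] (h : S →+* S')
    (R : Subring S) (R' : Subring S') (hR : ∀ r ∈ R, h r ∈ R') (I : Submodule R S) :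
    spanImage h R R' hR I = span R' (h '' I) := rfl

theorem Submodule.spanImage_spanImage_of_leftInverse {S S' : Type*} [CommRing S] [CommRing S']
    {h : S →+* S'} {h' : S' →+* S} {R : Subring S} {R' : Subring S'} (hR : ∀ r ∈ R, h r ∈ R')
    (hR' : ∀ r ∈ R', h' r ∈ R) (hh : Function.LeftInverse h' h) (I : Submodule R S) :
    spanImage h' R' R hR' (spanImage h R R' hR I) = I := by
  refine le_antisymm (span_le.mpr ?_) fun x hx ↦
    subset_span ⟨h x, subset_span ⟨x, hx, rfl⟩, hh x⟩
  rintro _ ⟨x, hx, rfl⟩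
  rw [SetLike.mem_coe, coe_spanImage] at hx
  induction hx using span_induction with
  | mem x hx =>
    obtain ⟨y, hy, rfl⟩ := hx
    rwa [hh y]
  | zero => rw [map_zero]; exact zero_mem I
  | add x y _ _ hx hy => rw [map_add]; exact add_mem hx hy
  | smul r x _ hx =>
    rw [Subring.smul_def, smul_eq_mul, map_mul]
    exact I.smul_mem ⟨h' r, hR' r r.2⟩ hx

theorem Submodule.exists_sum_mul_of_mem_mul {R S : Type*} [CommSemiring R] [Semiring S]
    [Algebra R S] {I J : Submodule R S} {x : S} (hx : x ∈ I * J) :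
    ∃ (ι : Type) (_ : Fintype ι) (f g : ι → S), (∀ i, f i ∈ I) ∧ (∀ i, g i ∈ J) ∧
      ∑ i, f i * g i = x := by
  induction hx using Submodule.mul_induction_on' with
  | mem_mul_mem x hx y hy =>
    exact ⟨Unit, inferInstance, fun _ ↦ x, fun _ ↦ y, fun _ ↦ hx, fun _ ↦ hy, by simp⟩
  | add x _ y _ hx hy =>
    obtain ⟨ι, _, f, g, hf, hg, rfl⟩ := hx
    obtain ⟨κ, _, f', g', hf', hg', rfl⟩ := hy
    exact ⟨ι ⊕ κ, inferInstance, Sum.elim f f', Sum.elim g g', Sum.forall.mpr ⟨hf, hf'⟩,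
      Sum.forall.mpr ⟨hg, hg'⟩, by simp⟩

namespace MonoidAlgebra
variable {B N : Type*} [CommRing B] [CancelCommMonoid N]

/-- The augmentation of `B[N]` killing the non-identity elements of a positive monoid `N`. -/
def coeffOneHom (B : Type*) [CommRing B] (hpos : IsPositiveMonoid N) :
    MonoidAlgebra B N →+* B where
  toFun x := x.coeff 1
  map_one' := coeff_one_one
  map_zero' := rfl
  map_add' _ _ := rfl
  map_mul' x y := by
    have h : UniqueMul x.coeff.support y.coeff.support 1 1 := fun a b _ _ hab ↦
      ⟨hpos a (.of_mul_eq_one b (hab.trans (one_mul 1))),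
        hpos b (.of_mul_eq_one a ((mul_comm b a).trans (hab.trans (one_mul 1))))⟩
    simpa using coeff_mul_mul_of_uniqueMul h

theorem leftInverse_coeffOneHom (hpos : IsPositiveMonoid N) :
    Function.LeftInverse (coeffOneHom B hpos) (singleOneRingHom : B →+* MonoidAlgebra B N) :=
  fun b ↦ by
    change (single (1 : N) b).coeff 1 = b
    simp

theorem eq_one_of_spanImage_eq_one [IsReduced B] [IsMulTorsionFree N] {A : Subring B}
    {M : Submonoid N} (hpos : IsPositiveMonoid N) (hA : A.IsSubintegrallyClosedIn)
    (hM : M.IsSubintegrallyClosedIn)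
    (hε : ∀ r ∈ monoidAlgebraSubring A M, coeffOneHom B hpos r ∈ A)
    (U : (Submodule (monoidAlgebraSubring A M) (MonoidAlgebra B N))ˣ)
    (hU : Units.map (Submodule.spanImage (coeffOneHom B hpos) _ A hε) U = 1) : U = 1 := by
  let R := monoidAlgebraSubring A M
  have hone {V : (Submodule R (MonoidAlgebra B N))ˣ}
      (hV : Units.map (Submodule.spanImage (coeffOneHom B hpos) _ A hε) V = 1)
      {x : MonoidAlgebra B N} (hx : x ∈ (V : Submodule R (MonoidAlgebra B N))) :
      x.coeff 1 ∈ A := by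
    have h : x.coeff 1 ∈ Submodule.spanImage (coeffOneHom B hpos) _ A hε V :=
      Submodule.subset_span ⟨x, hx, rfl⟩
    rw [show Submodule.spanImage (coeffOneHom B hpos) _ A hε V = 1 from congr_arg Units.val hV] at h
    obtain ⟨a, ha⟩ := Submodule.mem_one.mp h
    exact ha ▸ a.2
  have hU' : Units.map (Submodule.spanImage (coeffOneHom B hpos) _ A hε) U⁻¹ = 1 := by
    rw [map_inv, hU, inv_one]
  have hmul {x y : MonoidAlgebra B N} (hx : x ∈ (U : Submodule R (MonoidAlgebra B N)))
      (hy : y ∈ ((U⁻¹ : (Submodule R (MonoidAlgebra B N))ˣ) : Submodule R _)) : x * y ∈ R := by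
    have h := Submodule.mul_mem_mul hx hy
    rw [U.mul_inv] at h
    obtain ⟨r, hr⟩ := Submodule.mem_one.mp h
    exact hr ▸ r.2
  obtain ⟨ι, _, f, g, hf, hg, h1⟩ := Submodule.exists_sum_mul_of_mem_mul
    (I := (U : Submodule R (MonoidAlgebra B N))) (J := (U⁻¹ : (Submodule R _)ˣ)) (x := 1)
    (by rw [U.mul_inv]; exact Submodule.one_le.mp le_rfl)
  have key := mem_monoidAlgebraSubring_of_mul_mem hpos hA hM f g
    (fun i j ↦ hmul (hf i) (hg j)) h1 (fun i ↦ hone hU (hf i)) fun i ↦ hone hU' (hg i)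
  have hle : (U : Submodule R (MonoidAlgebra B N)) ≤ 1 := fun x hx ↦ by
    refine Submodule.mem_one.mpr ⟨⟨x, ?_⟩, rfl⟩
    rw [← mul_one x, ← h1, Finset.mul_sum]
    refine sum_mem fun i _ ↦ ?_
    rw [mul_left_comm]
    exact mul_mem (key i).1 (hmul hx (hg i))
  have hge : 1 ≤ (U : Submodule R (MonoidAlgebra B N)) := by
    rw [Submodule.one_le, ← h1]
    exact sum_mem fun i _ ↦ by
      rw [mul_comm]
      exact Submodule.smul_mem _ (⟨g i, (key i).2⟩ : R) (hf i)
  exact Units.ext (le_antisymm hle hge)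

end MonoidAlgebra

/-- **Sarwar, Theorem 1.2(b).**  If `A ⊆ B` is an extension of commutative rings with `B`
reduced, `M ⊆ N` an extension of positive commutative cancellative torsion-free monoids,
`A` is subintegrally closed in `B` and `M` is subintegrally closed in `N`, then the canonical
map `θ : 𝓘(A,B) → 𝓘(A[M],B[N])` is an isomorphism. -/
theorem theta_isIso_of_subintegrallyClosed_of_isReduced
    {B : Type*} [CommRing B] [IsReduced B] (A : Subring B)
    {N : Type*} [CancelCommMonoid N] (M : Submonoid N)
    (htf : MulTorsionFree N) (hpos : IsPositiveMonoid N)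
    (hA : A.IsSubintegrallyClosedIn) (hM : M.IsSubintegrallyClosedIn) :
    ThetaIsIso A M := by
  have : IsMulTorsionFree N := ⟨fun n hn x y h ↦ htf x y n hn h⟩
  have hι : ∀ a ∈ A, (MonoidAlgebra.singleOneRingHom : B →+* MonoidAlgebra B N) a ∈
      monoidAlgebraSubring A M := fun a ha ↦ Subring.subset_closure ⟨a, ha, 1, one_mem M, rfl⟩
  have hε : ∀ r ∈ monoidAlgebraSubring A M, MonoidAlgebra.coeffOneHom B hpos r ∈ A := fun r hr ↦
    (MonoidAlgebra.coeff_mem_of_mem_monoidAlgebraSubring hr 1).1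
  let θ := Units.map (Submodule.spanImage
    (MonoidAlgebra.singleOneRingHom : B →+* MonoidAlgebra B N) A (monoidAlgebraSubring A M) hι)
  let ε := Units.map (Submodule.spanImage (MonoidAlgebra.coeffOneHom B hpos)
    (monoidAlgebraSubring A M) A hε)
  have hεθ : Function.LeftInverse ε θ := fun I ↦ Units.ext <|
    Submodule.spanImage_spanImage_of_leftInverse hι hε
      (MonoidAlgebra.leftInverse_coeffOneHom hpos) _
  have hsurj : Function.Surjective θ := fun U ↦ ⟨ε U, by
    have h : U * (θ (ε U))⁻¹ = 1 :=
      MonoidAlgebra.eq_one_of_spanImage_eq_one hpos hA hM hε _ (by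
        change ε _ = 1
        rw [map_mul, map_inv, hεθ, mul_inv_cancel])
    exact (mul_inv_eq_one.mp h).symm⟩
  exact ⟨MulEquiv.ofBijective θ ⟨hεθ.injective, hsurj⟩, fun I ↦ rfl⟩
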